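/- If λ is a rectangular partition with N = bn boxes (b rows and n columns), then p^N(T) = T for every standard Young tableau T of shape λ, where p denotes jeu de taquin promotion. -/

import Mathlib

/-! ### Tableau machinery: fillings as functions `ℕ × ℕ → ℕ` (entry `0` = empty/absent cell) -/

/-- One jeu de taquin slide: starting from an empty box at position `c`, repeatedly swap the
empty box with the smaller of the entries directly to its right and directly below it
(`0` denotes an empty/absent cell), until neither exists.  Returns the resulting filling
together with the final position of the empty box; `fuel` bounds the number of steps. -/
def jdtSlide : ℕ → ((ℕ × ℕ) → ℕ) → (ℕ × ℕ) → (((ℕ × ℕ) → ℕ) × (ℕ × ℕ))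
  | 0, f, c => (f, c)
  | fuel+1, f, c =>
    let a := c.1
    let b := c.2
    let r := f (a, b+1)
    let d := f (a+1, b)
    if r = 0 ∧ d = 0 then (f, c)
    else if d = 0 ∨ (r ≠ 0 ∧ r < d) then
      jdtSlide fuel (Function.update (Function.update f (a, b+1) 0) (a, b) r) (a, b+1)
    else
      jdtSlide fuel (Function.update (Function.update f (a+1, b) 0) (a, b) d) (a+1, b)

/-- Jeu de taquin promotion of a standard filling with `N` boxes: delete the entry `1`
(in the upper left corner `(0,0)`), decrease every other entry by `1`, slide the empty box
by jeu de taquin, and fill the final empty box with `N`. -/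
def promote (N : ℕ) (f : (ℕ × ℕ) → ℕ) : (ℕ × ℕ) → ℕ :=
  let s := jdtSlide N (fun c => f c - 1) (0, 0)
  Function.update s.1 s.2 N

/-- The cells of the (straight-shape) Young diagram of a partition `lam`:
row `a` consists of the cells `(a, b)` with `b < lam a`. -/
def strCell (lam : List ℕ) (c : ℕ × ℕ) : Prop := c.2 < lam.getD c.1 0

/-- The cells of the shifted Young diagram of a strict partition `lam`:
row `a` consists of the cells `(a, b)` with `a ≤ b < a + lam a`. -/
def shiftCell (lam : List ℕ) (c : ℕ × ℕ) : Prop :=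
  c.1 ≤ c.2 ∧ c.2 < c.1 + lam.getD c.1 0

/-- `IsStdFilling cells N f` : `f` is a standard tableau on the cell set `cells` with
entries `1, …, N`: it vanishes off `cells`, restricts to a bijection `cells → {1, …, N}`,
and is strictly increasing along rows and columns. -/
def IsStdFilling (cells : ℕ × ℕ → Prop) (N : ℕ) (f : (ℕ × ℕ) → ℕ) : Prop :=
  (∀ c, ¬ cells c → f c = 0) ∧
  (∀ c, cells c → 1 ≤ f c ∧ f c ≤ N) ∧
  (∀ c c', cells c → cells c' → f c = f c' → c = c') ∧
  (∀ v, 1 ≤ v → v ≤ N → ∃ c, cells c ∧ f c = v) ∧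
  (∀ a b, cells (a, b) → cells (a, b+1) → f (a, b) < f (a, b+1)) ∧
  (∀ a b, cells (a, b) → cells (a+1, b) → f (a, b) < f (a+1, b))

/-- The rectangular partition with `b` rows and `n` columns. -/
def rectShape (b n : ℕ) : List ℕ := List.replicate b n

/-- The square partition with `n` rows and `n` columns. -/
def sqShape (n : ℕ) : List ℕ := List.replicate n n

/-- The doubled staircase strict partition `(2n-1, 2n-3, …, 1)`. -/
def dblStair (n : ℕ) : List ℕ := (List.range n).map (fun i => 2*n - 1 - 2*i)

/-- The index of the row containing the entry `v` of a filling
(rows numbered `0, 1, 2, …` from the top). -/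
noncomputable def rowOf (f : (ℕ × ℕ) → ℕ) (v : ℕ) : ℕ := sInf {a | ∃ b, f (a, b) = v}

namespace PromRect

/-- Slide a hole of content `p` through the letters of a content word. -/
def push : ℤ → List ℤ → List ℤ × ℤ
  | p, [] => ([], p)
  | p, q :: S =>
    if p = q + 1 ∨ q = p + 1 then (p :: (push q S).1, (push q S).2)
    else (q :: (push p S).1, (push p S).2)

/-- Tableau switching on content words. -/
def switch : List ℤ → List ℤ → List ℤ × List ℤ
  | [], S => (S, [])
  | e :: E, S => ((push e (switch E S).1).1, (push e (switch E S).1).2 :: (switch E S).2)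

/-- Relational tableau switching. -/
inductive Sw : List ℤ → List ℤ → List ℤ → List ℤ → Prop
  | nilL (S) : Sw [] S S []
  | nilR (U) : Sw U [] [] U
  | adj (p q : ℤ) (h : p = q + 1 ∨ q = p + 1) : Sw [p] [q] [p] [q]
  | far (p q : ℤ) (h : ¬ (p = q + 1 ∨ q = p + 1)) : Sw [p] [q] [q] [p]
  | appU {U1 U2 S S1 S2 U1' U2'} : Sw U2 S S1 U2' → Sw U1 S1 S2 U1' →
      Sw (U1 ++ U2) S S2 (U1' ++ U2')
  | appS {U S1 S2 S1' S2' U1 U2} : Sw U S1 S1' U1 → Sw U1 S2 S2' U2 →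
      Sw U (S1 ++ S2) (S1' ++ S2') U2

theorem Sw.symm {U S S' U'} (h : Sw U S S' U') : Sw S' U' U S := by
  induction h with
  | nilL S => exact .nilR _
  | nilR U => exact .nilL _
  | adj p q h => exact .adj p q h
  | far p q h => exact .far q p (by tauto)
  | appU _ _ h1 h2 => exact .appS h2 h1
  | appS _ _ h1 h2 => exact .appU h2 h1

theorem Sw.rev {U S S' U'} (h : Sw U S S' U') :
    Sw S.reverse U.reverse U'.reverse S'.reverse := by
  induction h with
  | nilL S => exact .nilR _
  | nilR U => exact .nilL _
  | adj p q h => exact .adj q p (by tauto)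
  | far p q h => exact .far q p (by tauto)
  | appU _ _ h1 h2 => simp only [List.reverse_append]; exact .appS h1 h2
  | appS _ _ h1 h2 => simp only [List.reverse_append]; exact .appU h1 h2

theorem push_append (p : ℤ) (S1 S2 : List ℤ) :
    push p (S1 ++ S2) = ((push p S1).1 ++ (push (push p S1).2 S2).1, (push (push p S1).2 S2).2) := by
  induction S1 generalizing p with
  | nil => simp [push]
  | cons q S1 ih => simp only [List.cons_append, push]; split_ifs <;> simp [ih]

theorem switch_nil (U : List ℤ) : switch U [] = ([], U) := by
  induction U with
  | nil => rfl
  | cons e U ih => simp [switch, ih, push]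

theorem switch_appU (U1 U2 S : List ℤ) : switch (U1 ++ U2) S =
    ((switch U1 (switch U2 S).1).1, (switch U1 (switch U2 S).1).2 ++ (switch U2 S).2) := by
  induction U1 with
  | nil => simp [switch]
  | cons e U1 ih => simp [switch, ih]

theorem switch_appS (U S1 S2 : List ℤ) : switch U (S1 ++ S2) =
    ((switch U S1).1 ++ (switch (switch U S1).2 S2).1, (switch (switch U S1).2 S2).2) := by
  induction U with
  | nil => simp [switch]
  | cons e U ih => simp [switch, ih, push_append]

theorem Sw.eq {U S S' U'} (h : Sw U S S' U') : switch U S = (S', U') := by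
  induction h with
  | nilL S => rfl
  | nilR U => exact switch_nil U
  | adj p q h => simp [switch, push, h]
  | far p q h => simp [switch, push, h]
  | appU _ _ h1 h2 => simp [switch_appU, h1, h2]
  | appS _ _ h1 h2 => simp [switch_appS, h1, h2]

theorem Sw.push (p : ℤ) (S : List ℤ) : Sw [p] S (push p S).1 [(push p S).2] := by
  induction S generalizing p with
  | nil => exact .nilR _
  | cons q S ih =>
    simp only [PromRect.push]
    split_ifs with h
    · exact .appS (S1 := [q]) (S1' := [p]) (.adj p q h) (ih q)
    · exact .appS (S1 := [q]) (S1' := [q]) (.far p q h) (ih p)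

theorem Sw.switch (U S : List ℤ) : Sw U S (switch U S).1 (switch U S).2 := by
  induction U with
  | nil => exact .nilL _
  | cons e U ih => exact .appU (U1 := [e]) (U1' := [_]) ih (Sw.push _ _)

theorem Sw.length {U S S' U'} (h : Sw U S S' U') :
    S'.length = S.length ∧ U'.length = U.length := by
  induction h <;> simp_all

/-- Move a particle from `c` to `c + 1`. -/
def hop (c : ℤ) (m : ℤ → Prop) : ℤ → Prop := fun x => x = c + 1 ∨ (x ≠ c ∧ m x)

/-- `w` is a legal sequence of hops between two states. -/
def Path (A : ℤ → Prop) : (ℤ → Prop) → List ℤ → (ℤ → Prop) → Prop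
  | m, [], m' => m = m'
  | m, c :: w, m' => A c ∧ m c ∧ ¬ m (c + 1) ∧ Path A (hop c m) w m'

variable {A : ℤ → Prop}

theorem path_append {m m'} (w1 w2 : List ℤ) :
    Path A m (w1 ++ w2) m' ↔ ∃ k, Path A m w1 k ∧ Path A k w2 m' := by
  induction w1 generalizing m with
  | nil => simp [Path]
  | cons c w ih => simp [Path, ih]; tauto

theorem Path.app {m k m' w1 w2} (h1 : Path A m w1 k) (h2 : Path A k w2 m') :
    Path A m (w1 ++ w2) m' := (path_append _ _).2 ⟨_, h1, h2⟩

theorem Path.det {m k k' w} (h1 : Path A m w k) (h2 : Path A m w k') : k = k' := by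
  induction w generalizing m with
  | nil => exact h1.symm.trans h2
  | cons c w ih => exact ih h1.2.2.2 h2.2.2.2

theorem hop_compl {c : ℤ} {m : ℤ → Prop} (h : m c) (h' : ¬ m (c + 1)) :
    hop c (fun x => ¬ hop c m x) = fun x => ¬ m x := by
  funext x
  simp only [hop, eq_iff_iff]
  by_cases h1 : x = c + 1
  · subst h1; simp [h']
  · by_cases h2 : x = c
    · subst h2; simp [h]
    · simp [h1, h2]

theorem hop_inj {c : ℤ} {m k : ℤ → Prop} (h : m c) (h' : ¬ m (c + 1)) (hk : k c)
    (hk' : ¬ k (c + 1)) (e : hop c m = hop c k) : m = k := by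
  have := hop_compl h h'
  rw [e, hop_compl hk hk'] at this
  funext x
  have := congrFun this x
  simp only [eq_iff_iff] at this ⊢
  tauto

theorem Path.compl {m m' w} (h : Path A m w m') :
    Path A (fun x => ¬ m' x) w.reverse (fun x => ¬ m x) := by
  induction w generalizing m with
  | nil => cases h; rfl
  | cons c w ih =>
    obtain ⟨ha, h1, h2, h3⟩ := h
    rw [List.reverse_cons]
    refine (ih h3).app ⟨ha, ?_, ?_, hop_compl h1 h2⟩
    · simp [hop]
    · simp [hop]

theorem Path.det' {m k m' w} (h1 : Path A m w m') (h2 : Path A k w m') : m = k := by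
  have := h1.compl.det h2.compl
  funext x
  have := congrFun this x
  simp only [eq_iff_iff] at this ⊢
  tauto

theorem hop_comm {p q : ℤ} (m : ℤ → Prop) (h : ¬ (p = q + 1 ∨ q = p + 1)) :
    hop p (hop q m) = hop q (hop p m) := by
  funext x
  simp only [hop, eq_iff_iff]
  grind

theorem Sw.path {U S S' U'} (h : Sw U S S' U') {m m'} (hp : Path A m (U ++ S) m') :
    Path A m (S' ++ U') m' := by
  induction h generalizing m m' with
  | nilL S => simpa using hp
  | nilR U => simpa using hp
  | adj p q h => exact hp
  | far p q h =>
    simp only [List.cons_append, List.nil_append, Path] at hp ⊢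
    rw [hop_comm m h]
    simp only [hop] at hp ⊢
    grind
  | appU _ _ h1 h2 =>
    rw [List.append_assoc, path_append] at hp
    obtain ⟨k, hp, hq⟩ := hp
    obtain ⟨l, h3, h4⟩ := (path_append _ _).1 (h1 hq)
    rw [← List.append_assoc]
    exact (h2 (hp.app h3)).app h4
  | appS _ _ h1 h2 =>
    rw [← List.append_assoc, path_append] at hp
    obtain ⟨k, hp, hq⟩ := hp
    obtain ⟨l, h3, h4⟩ := (path_append _ _).1 (h1 hp)
    rw [List.append_assoc]
    exact h3.app (h2 (h4.app hq))

/-- Elementary dual equivalence of three-letter words. -/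
def D (t t' : List ℤ) : Prop := ∃ x z y : ℤ, ((x < z ∧ z < y) ∨ (y < z ∧ z < x)) ∧
  ((t = [z, x, y] ∧ t' = [z, y, x]) ∨ (t = [x, y, z] ∧ t' = [y, x, z]))

theorem D_intro {a b c a' b' c' : ℤ}
    (h : (a = a' ∧ b = c' ∧ c = b' ∧ ((b < a ∧ a < c) ∨ (c < a ∧ a < b))) ∨
      (c = c' ∧ a = b' ∧ b = a' ∧ ((a < c ∧ c < b) ∨ (b < c ∧ c < a)))) :
    D [a, b, c] [a', b', c'] := by
  rcases h with ⟨rfl, rfl, rfl, h⟩ | ⟨rfl, rfl, rfl, h⟩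
  · exact ⟨_, _, _, h, .inl ⟨rfl, rfl⟩⟩
  · exact ⟨_, _, _, h, .inr ⟨rfl, rfl⟩⟩

theorem singleton_pair {a b : ℤ} {P : Prop} (h1 : a = b) (h2 : P) : [a] = [b] ∧ P := ⟨by rw [h1], h2⟩

set_option maxHeartbeats 2000000 in
theorem D_step {m m' m'' t t' s} (hD : D t t') (h : Path A m (t ++ [s]) m')
    (h' : Path A m (t' ++ [s]) m'') :
    (switch t [s]).1 = (switch t' [s]).1 ∧ D (switch t [s]).2 (switch t' [s]).2 := by
  obtain ⟨x, z, y, hb, ⟨rfl, rfl⟩ | ⟨rfl, rfl⟩⟩ := hD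
  · have hs : s ≠ x ∧ s ≠ y ∧
        (s = z → (x + 1 = z ∧ z + 1 = y) ∨ (y + 1 = z ∧ z + 1 = x)) := by
      simp only [List.cons_append, List.nil_append, Path, hop] at h h'
      grind
    simp only [switch, push]
    clear h h'
    obtain ⟨h1, h2, h3⟩ := hs
    split_ifs <;> (try (exfalso; omega)) <;> simp only [push] <;>
      split_ifs <;> (try (exfalso; omega)) <;> simp only [push] <;>
      split_ifs <;> (try (exfalso; omega)) <;>
      first
      | (refine singleton_pair ?_ (D_intro ?_) <;> omega)
      | (refine ⟨trivial, D_intro ?_⟩; dsimp only; omega)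
  · have hs : s ≠ x ∧ s ≠ y ∧ s ≠ z := by
      simp only [List.cons_append, List.nil_append, Path, hop] at h h'
      grind
    simp only [switch, push]
    clear h h'
    obtain ⟨h1, h2, h3⟩ := hs
    split_ifs <;> (try (exfalso; omega)) <;> simp only [push] <;>
      split_ifs <;> (try (exfalso; omega)) <;> simp only [push] <;>
      split_ifs <;> (try (exfalso; omega)) <;>
      first
      | (refine singleton_pair ?_ (D_intro ?_) <;> omega)
      | (refine ⟨trivial, D_intro ?_⟩; dsimp only; omega)

theorem D_switch {t t' S} (hD : D t t') {m m' m''} (h : Path A m (t ++ S) m')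
    (h' : Path A m (t' ++ S) m'') : (switch t S).1 = (switch t' S).1 := by
  induction S generalizing t t' m m' m'' with
  | nil => simp [switch_nil]
  | cons s S ih =>
    have e : s :: S = [s] ++ S := rfl
    rw [e, ← List.append_assoc] at h h'
    obtain ⟨k, h1, h2⟩ := (path_append _ _).1 h
    obtain ⟨k', h1', h2'⟩ := (path_append _ _).1 h'
    obtain ⟨e1, e2⟩ := D_step hD h1 h1'
    rw [e, switch_appS, switch_appS t']
    have q1 := (Sw.switch t [s]).path h1
    have q2 := (Sw.switch t' [s]).path h1'
    rw [← e1] at q2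
    obtain ⟨j, a1, a2⟩ := (path_append _ _).1 q1
    obtain ⟨j', b1, b2⟩ := (path_append _ _).1 q2
    obtain rfl := a1.det b1
    simp only [e1, ih e2 (a2.app h2) (b2.app h2')]

theorem path_snoc {m m' w c} : Path A m (w ++ [c]) m' ↔
    ∃ k, Path A m w k ∧ A c ∧ k c ∧ ¬ k (c + 1) ∧ hop c k = m' := by
  simp [path_append, Path]

/-- Reachability is closed under removing boxes. -/
theorem reach_remove {m0 : ℤ → Prop} (h0 : ∀ z, A z → m0 (z + 1) → m0 z) (n : ℕ) :
    ∀ (w : List ℤ) (k : ℤ → Prop) (z : ℤ), w.length = n → Path A m0 w k → A z → ¬ k z →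
    k (z + 1) → ∃ w' k', w'.length + 1 = n ∧ Path A m0 w' k' ∧ k' z ∧ ¬ k' (z + 1) ∧
      hop z k' = k := by
  induction n with
  | zero =>
    intro w k z hw hp hA h1 h2
    obtain rfl := List.length_eq_zero_iff.1 hw
    cases hp
    exact absurd (h0 z hA h2) h1
  | succ n ih =>
    intro w k z hw hp hA h1 h2
    obtain rfl | ⟨v, c, rfl⟩ := List.eq_nil_or_concat' w
    · simp at hw
    obtain ⟨j, hj, hAc, hc, hc', rfl⟩ := path_snoc.1 hp
    simp at hw
    by_cases hcz : c = z
    · subst hcz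
      exact ⟨v, j, by omega, hj, hc, hc', rfl⟩
    · have hne : ¬ (c = z + 1 ∨ z = c + 1) := by
        simp only [hop] at h1 h2; grind
      obtain ⟨w', k', hl, hp', g1, g2, rfl⟩ := ih v j z hw hj hA
        (by simp only [hop] at h1; grind) (by simp only [hop] at h2; grind)
      refine ⟨w' ++ [c], hop c k', by simp; omega, path_snoc.2 ⟨k', hp', hAc, ?_, ?_, rfl⟩, ?_, ?_,
        (hop_comm _ hne).symm⟩
      all_goals (try simp only [hop] at *); grind

theorem exists_between {k : ℤ → Prop} {x y : ℤ} (h : x < y) (hx : ¬ k x) (hy : k y) :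
    ∃ z, x ≤ z ∧ z < y ∧ ¬ k z ∧ k (z + 1) := by
  by_contra hcon
  push Not at hcon
  have : ∀ n : ℕ, x + n ≤ y → ¬ k (x + n) := by
    intro n
    induction n with
    | zero => simpa using fun _ => hx
    | succ n ih =>
      intro hn
      push_cast at hn ⊢
      have := hcon (x + n) (by omega) (by omega) (ih (by omega))
      rwa [add_assoc] at this
  refine this (y - x).toNat (by omega) ?_
  rwa [show x + ((y - x).toNat : ℤ) = y by omega]

/-- Confluence of rectification. -/
theorem confluence (hA : ∀ x y z, A x → A y → x < z → z < y → A z)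
    {m0 : ℤ → Prop} (h0 : ∀ z, A z → m0 (z + 1) → m0 z) (n : ℕ) :
    ∀ (U V : List ℤ) (k : ℤ → Prop), U.length = n → Path A m0 U k → Path A m0 V k →
    ∀ (S : List ℤ) (m' : ℤ → Prop), Path A k S m' → (switch U S).1 = (switch V S).1 := by
  induction n with
  | zero =>
    intro U V k hU pU pV S m' pS
    obtain rfl := List.length_eq_zero_iff.1 hU
    obtain rfl | ⟨W, c, rfl⟩ := List.eq_nil_or_concat' V
    · rfl
    · obtain ⟨j, hj, hAc, hc, hc', e⟩ := path_snoc.1 pV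
      cases pU
      have := h0 c hAc (by rw [← e]; simp [hop])
      rw [← e] at this
      simp [hop] at this
  | succ n ih =>
    have same : ∀ (U V : List ℤ) (x : ℤ) (k : ℤ → Prop), U.length = n → Path A m0 (U ++ [x]) k →
        Path A m0 (V ++ [x]) k → ∀ (S : List ℤ) (m' : ℤ → Prop), Path A k S m' →
        (switch (U ++ [x]) S).1 = (switch (V ++ [x]) S).1 := by
      intro U V x k hU pU pV S m' pS
      rw [switch_appU, switch_appU V]
      obtain ⟨j, hj, hAc, hc, hc', rfl⟩ := path_snoc.1 pU
      obtain ⟨j', hj', -, gc, gc', e⟩ := path_snoc.1 pV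
      obtain rfl := hop_inj gc gc' hc hc' e
      have : Path A j' ([x] ++ S) m' := ⟨hAc, gc, gc', pS⟩
      obtain ⟨l, h1, h2⟩ := (path_append _ _).1 ((Sw.switch _ _).path this)
      exact ih U V j' hU hj hj' _ _ h1
    intro U V k hU pU pV S m' pS
    obtain rfl | ⟨U, x, rfl⟩ := List.eq_nil_or_concat' U
    · simp at hU
    simp at hU
    obtain ⟨j, hj, hAx, hx, hx', rfl⟩ := path_snoc.1 pU
    obtain rfl | ⟨V, y, rfl⟩ := List.eq_nil_or_concat' V
    · cases pV
      have := h0 x hAx (by simp [hop])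
      simp [hop] at this
    by_cases hxy : x = y
    · subst hxy
      exact same U V x _ hU pU pV S m' pS
    obtain ⟨i, hi, hAy, hy, hy', e⟩ := path_snoc.1 pV
    have hk : ¬ hop x j y := by rw [← e]; simp [hop]
    have hk' : hop x j (y + 1) := by rw [← e]; simp [hop]
    have hk2 : ¬ hop y i x := by rw [e]; simp [hop]
    have hk2' : hop y i (x + 1) := by rw [e]; simp [hop]
    have hne : ¬ (x = y + 1 ∨ y = x + 1) := by
      simp only [hop] at hk hk' hk2 hk2'; grind
    obtain ⟨w1, κ, hl1, pκ, hκy, hκy', rfl⟩ := reach_remove h0 n U j y hU hj hAy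
      (by simp only [hop] at hk; grind) (by simp only [hop] at hk'; grind)
    have hκx : κ x := by simp only [hop] at hx; grind
    have hκx' : ¬ κ (x + 1) := by simp only [hop] at hx'; grind
    have hz : ∃ z, ((x < z ∧ z < y) ∨ (y < z ∧ z < x)) ∧ A z ∧ ¬ κ z ∧ κ (z + 1) := by
      rcases lt_or_gt_of_ne hxy with h | h
      · obtain ⟨z, a, b, c, d⟩ := exists_between (by omega : x + 1 < y) hκx' hκy
        exact ⟨z, by omega, hA x y z hAx hAy (by omega) (by omega), c, d⟩
      · obtain ⟨z, a, b, c, d⟩ := exists_between (by omega : y + 1 < x) hκy' hκx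
        exact ⟨z, by omega, hA y x z hAy hAx (by omega) (by omega), c, d⟩
    obtain ⟨z, hb, hAz, hz, hz'⟩ := hz
    obtain ⟨w2, ι, hl2, pι, hιz, hιz', rfl⟩ := reach_remove h0 _ w1 κ z rfl pκ hAz hz hz'
    have tri1 : Path A ι [z, y, x] (hop x (hop y (hop z ι))) :=
      ⟨hAz, hιz, hιz', hAy, hκy, hκy', hAx, hx, hx', rfl⟩
    have tri2 : Path A ι [z, x, y] (hop x (hop y (hop z ι))) := by
      refine ⟨hAz, hιz, hιz', hAx, hκx, hκx', hAy, ?_, ?_, (hop_comm _ hne).symm⟩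
      · simp only [hop] at *; grind
      · simp only [hop] at *; grind
    have s1 : (switch (U ++ [x]) S).1 = (switch ((w2 ++ [z, y]) ++ [x]) S).1 := by
      refine same U _ x _ hU pU ?_ S m' pS
      simpa using pι.app tri1
    have s3 : (switch (V ++ [y]) S).1 = (switch ((w2 ++ [z, x]) ++ [y]) S).1 := by
      refine (same (w2 ++ [z, x]) V y _ (by simp; omega) ?_ pV S m' pS).symm
      simpa using pι.app tri2
    have s2 : (switch (w2 ++ [z, x, y]) S).1 = (switch (w2 ++ [z, y, x]) S).1 := by
      rw [switch_appU, switch_appU w2]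
      rw [D_switch ⟨x, z, y, hb, .inl ⟨rfl, rfl⟩⟩ (tri2.app pS) (tri1.app pS)]
    rw [s1, s3]
    simpa using s2.symm

/-- `μ` and `ν` are complementary: opposite corners of a growth rectangle. -/
theorem R_functional (hA : ∀ x y z, A x → A y → x < z → z < y → A z)
    {m0 mR : ℤ → Prop} (h0 : ∀ z, A z → m0 (z + 1) → m0 z) (hR : ∀ z, A z → mR z → mR (z + 1))
    {U V S T ν μ μ'} (pU : Path A m0 U ν) (pV : Path A m0 V ν) (pS : Path A ν S mR)
    (pT : Path A ν T mR) (h1 : Path A m0 (switch U S).1 μ) (h2 : Path A m0 (switch V T).1 μ') :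
    μ = μ' := by
  rw [confluence hA h0 _ U V ν rfl pU pV S mR pS] at h1
  have aux : ∀ S μ, Path A ν S mR → Path A m0 (switch V S).1 μ → Path A μ (switch V S).2 mR ∧
      switch S.reverse V.reverse = ((switch V S).2.reverse, (switch V S).1.reverse) := by
    intro S μ pS h
    refine ⟨?_, (Sw.switch V S).rev.eq⟩
    obtain ⟨j, a, b⟩ := (path_append _ _).1 ((Sw.switch V S).path (pV.app pS))
    rwa [h.det a]
  obtain ⟨a1, a2⟩ := aux S μ pS h1
  obtain ⟨b1, b2⟩ := aux T μ' pT h2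
  have := confluence hA (m0 := fun x => ¬ mR x) (fun z hz h h' => h (hR z hz h')) _
    S.reverse T.reverse _ rfl pS.compl pT.compl V.reverse _ pV.compl
  rw [a2, b2] at this
  have e : (switch V S).2 = (switch V T).2 := List.reverse_injective this
  rw [e] at a1
  exact a1.det' b1

/-- Promotion of content words. -/
def prom : List ℤ → List ℤ
  | [] => []
  | u :: S => (push u S).1 ++ [(push u S).2]

theorem prom_path {m m' w} (h : Path A m w m') : Path A m (prom w) m' := by
  cases w with
  | nil => exact h
  | cons u S => exact (Sw.push u S).path h

theorem prom_length (w : List ℤ) : (prom w).length = w.length := by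
  cases w with
  | nil => rfl
  | cons u S => simp [prom, (Sw.push u S).length.1]

theorem prom_iter {m0} (i : ℕ) : ∀ (U S : List ℤ) (μ m' : ℤ → Prop), U.length = i →
    Path A m0 U μ → Path A μ S m' → ∃ E V, E.length = i ∧ Path A m0 E μ ∧
      prom^[i] (U ++ S) = (switch E S).1 ++ V := by
  induction i with
  | zero =>
    intro U S μ m' hU pU pS
    exact ⟨U, [], hU, pU, by obtain rfl := List.length_eq_zero_iff.1 hU; simp [switch]⟩
  | succ i ih =>
    intro U S μ m' hU pU pS
    obtain _ | ⟨u, U⟩ := U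
    · simp at hU
    have p1 := (Sw.push u U).path pU
    obtain ⟨κ, a, b⟩ := (path_append _ _).1 p1
    have p2 := (Sw.push (push u U).2 S).path (b.app pS)
    have hl := (Sw.push u U).length.1
    obtain ⟨E, V, hE, pE, e⟩ := ih _ _ κ m' (by simpa [hl] using hU) a p2
    refine ⟨E ++ [(push u U).2], (switch (switch E (push (push u U).2 S).1).2
      [(push (push u U).2 S).2]).1 ++ V, by simp [hE], pE.app b, ?_⟩
    rw [Function.iterate_succ_apply, switch_appU]
    have : prom (u :: U ++ S) = (push u U).1 ++ ((push (push u U).2 S).1 ++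
        [(push (push u U).2 S).2]) := by
      simp [prom, push_append]
    rw [this, e, switch_appS]
    simp [switch]

theorem path_iter {m m' w} (h : Path A m w m') (i : ℕ) : Path A m (prom^[i] w) m' := by
  induction i with
  | zero => exact h
  | succ i ih => rw [Function.iterate_succ_apply']; exact prom_path ih

theorem length_iter (w : List ℤ) (i : ℕ) : (prom^[i] w).length = w.length := by
  induction i with
  | zero => rfl
  | succ i ih => rw [Function.iterate_succ_apply', prom_length, ih]

/-- Prefixes of `prom^N w` reach the same states as those of `w`. -/
theorem prom_state (hA : ∀ x y z, A x → A y → x < z → z < y → A z)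
    {m0 mR : ℤ → Prop} (h0 : ∀ z, A z → m0 (z + 1) → m0 z) (hR : ∀ z, A z → mR z → mR (z + 1))
    {U S μ} (pU : Path A m0 U μ) (pS : Path A μ S mR) :
    ∃ X Y, prom^[(U ++ S).length] (U ++ S) = X ++ Y ∧ X.length = U.length ∧ Path A m0 X μ := by
  obtain ⟨E, V, hE, pE, e⟩ := prom_iter U.length U S μ mR rfl pU pS
  have pi := path_iter (pU.app pS) U.length
  have li := length_iter (U ++ S) U.length
  rw [e] at pi li
  have lE := (Sw.switch E S).length
  obtain ⟨ν, q1, q2⟩ := (path_append _ _).1 pi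
  obtain ⟨ν', r1, r2⟩ := (path_append _ _).1 ((Sw.switch E S).path (pE.app pS))
  obtain rfl := q1.det r1
  obtain ⟨E2, V2, hE2, pE2, e2⟩ := prom_iter _ _ V ν mR rfl q1 q2
  obtain ⟨μ', s1, s2⟩ := (path_append _ _).1 ((Sw.switch E2 V).path (pE2.app q2))
  have sy := (Sw.switch E S).symm.eq
  have : μ = μ' := R_functional hA h0 hR q1 pE2 r2 q2 (by rw [sy]; exact pE) s1
  subst this
  refine ⟨(switch E2 V).1, V2, ?_, ?_, s1⟩
  · rw [List.length_append, add_comm, Function.iterate_add_apply, e, ← e2, lE.1]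
  · rw [(Sw.switch E2 V).length.1]
    simp [lE.1] at li
    omega

theorem hop_eq {c d : ℤ} {m : ℤ → Prop} (h : ¬ m (c + 1)) (e : hop c m = hop d m) : c = d := by
  have : hop d m (c + 1) := by rw [← e]; simp [hop]
  simp only [hop] at this
  rcases this with h1 | h1
  · omega
  · exact absurd h1.2 h

theorem path_unique (w : List ℤ) : ∀ (v : List ℤ) (m m' : ℤ → Prop), v.length = w.length →
    Path A m w m' → Path A m v m' →
    (∀ U S μ, w = U ++ S → Path A m U μ → ∃ X Y, v = X ++ Y ∧ X.length = U.length ∧ Path A m X μ) →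
    v = w := by
  induction w with
  | nil => intro v m m' h _ _ _; simpa using h
  | cons c w ih =>
    intro v m m' hl pw pv H
    obtain _ | ⟨d, v⟩ := v
    · simp at hl
    obtain ⟨hAc, h1, h2, h3⟩ := pw
    obtain ⟨hAd, g1, g2, g3⟩ := pv
    have hcd : d = c := by
      obtain ⟨X, Y, e, lX, pX⟩ := H [c] w (hop c m) rfl ⟨hAc, h1, h2, rfl⟩
      obtain ⟨x, rfl⟩ := List.length_eq_one_iff.1 lX
      simp at e
      obtain ⟨rfl, rfl⟩ := e
      exact hop_eq g2 pX.2.2.2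
    subst hcd
    congr 1
    refine ih v _ m' (by simpa using hl) h3 g3 ?_
    intro U S μ e pU
    obtain ⟨X, Y, e', lX, pX⟩ := H (d :: U) S μ (by simp [e]) ⟨hAc, h1, h2, pU⟩
    obtain _ | ⟨x, X⟩ := X
    · simp at lX
    simp at e'
    obtain ⟨rfl, rfl⟩ := e'
    exact ⟨X, Y, rfl, by simpa using lX, pX.2.2.2⟩

theorem prom_order (hA : ∀ x y z, A x → A y → x < z → z < y → A z)
    {m0 mR : ℤ → Prop} (h0 : ∀ z, A z → m0 (z + 1) → m0 z) (hR : ∀ z, A z → mR z → mR (z + 1))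
    {w} (p : Path A m0 w mR) : prom^[w.length] w = w := by
  refine path_unique w _ m0 mR (length_iter _ _) p (path_iter p _) ?_
  rintro U S μ rfl pU
  obtain ⟨μ', a, b⟩ := (path_append _ _).1 p
  obtain rfl := pU.det a
  exact prom_state hA h0 hR a b

/-! ### Linking tableaux and content words -/

/-- The content of a cell. -/
def cont (c : ℕ × ℕ) : ℤ := (c.2 : ℤ) - c.1

open Classical in
/-- The content of the cell containing the entry `v`. -/
noncomputable def W (f : ℕ × ℕ → ℕ) (v : ℕ) : ℤ :=
  if h : ∃ d, f d = v then cont h.choose else 0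

theorem W_eq {f : ℕ × ℕ → ℕ} (inj : ∀ d e, f d ≠ 0 → f d = f e → d = e) {d : ℕ × ℕ} {v : ℕ}
    (hv : v ≠ 0) (h : f d = v) : W f v = cont d := by
  have h' : ∃ d, f d = v := ⟨d, h⟩
  unfold W
  rw [dif_pos h']
  congr 1
  refine (inj d _ (by omega) ?_).symm
  rw [h'.choose_spec, h]

/-- A standard filling of the rectangle. -/
structure Std (b n : ℕ) (f : ℕ × ℕ → ℕ) : Prop where
  zero : ∀ a j, ¬ (a < b ∧ j < n) → f (a, j) = 0
  pos : ∀ a j, a < b → j < n → f (a, j) ≠ 0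
  le : ∀ d, f d ≤ b * n
  inj : ∀ d e, f d ≠ 0 → f d = f e → d = e
  surj : ∀ v, v ≠ 0 → v ≤ b * n → ∃ d, f d = v
  mono : ∀ a j a' j', a' < b → j' < n → a ≤ a' → j ≤ j' → f (a, j) ≤ f (a', j')

theorem Std.mem {b n f} (h : Std b n f) {a j} (h' : f (a, j) ≠ 0) : a < b ∧ j < n := by
  by_contra hc; exact h' (h.zero a j hc)

theorem Std.smono {b n f} (h : Std b n f) {a j a' j' : ℕ} (h1 : a' < b) (h2 : j' < n) (h3 : a ≤ a')
    (h4 : j ≤ j') (h5 : a < a' ∨ j < j') : f (a, j) < f (a', j') := by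
  refine lt_of_le_of_ne (h.mono _ _ _ _ h1 h2 h3 h4) fun e => ?_
  have := h.inj _ _ (h.pos a j (by omega) (by omega)) e
  simp at this
  omega

theorem Std.of {b n f} (h : IsStdFilling (strCell (rectShape b n)) (b * n) f) : Std b n f := by
  have hc : ∀ a j, strCell (rectShape b n) (a, j) ↔ a < b ∧ j < n := by
    intro a j
    simp only [strCell, rectShape]
    by_cases ha : a < b
    · simp [List.getD, ha]
    · simp [List.getD, ha]
  obtain ⟨h1, h2, h3, h4, h5, h6⟩ := h
  have z : ∀ a j, ¬ (a < b ∧ j < n) → f (a, j) = 0 := fun a j h => h1 _ (by rwa [hc])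
  have mem : ∀ d, f d ≠ 0 → strCell (rectShape b n) d := fun d hd => by
    by_contra h; exact hd (h1 d h)
  refine ⟨z, fun a j ha hj => ?_, fun d => ?_, fun d e hd he => ?_, fun v hv hv' => ?_, ?_⟩
  · have := (h2 (a, j) ((hc a j).2 ⟨ha, hj⟩)).1
    omega
  · by_cases hd : f d = 0
    · omega
    · exact (h2 d (mem d hd)).2
  · exact h3 d e (mem d hd) (mem e (by omega)) he
  · obtain ⟨c, -, h⟩ := h4 v (by omega) hv'
    exact ⟨c, h⟩
  · intro a j a' j' ha' hj' ha hj
    have r : f (a, j) ≤ f (a, j') := by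
      induction j', hj using Nat.le_induction with
      | base => exact le_rfl
      | succ i hi ih =>
        exact (ih (by omega)).trans
          (h5 a i ((hc _ _).2 (by omega)) ((hc _ _).2 (by omega))).le
    refine r.trans ?_
    clear r
    induction a', ha using Nat.le_induction with
    | base => exact le_rfl
    | succ i hi ih =>
      exact (ih (by omega)).trans
        (h6 i j' ((hc _ _).2 (by omega)) ((hc _ _).2 (by omega))).le

/-- The content word of a filling. -/
noncomputable def word (N : ℕ) (f : ℕ × ℕ → ℕ) : List ℤ := (List.range' 1 N).map (W f)

theorem Std.ext {b n f g} (hf : Std b n f) (hg : Std b n g)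
    (h : word (b * n) f = word (b * n) g) : f = g := by
  have hW : ∀ k, k ≠ 0 → k ≤ b * n → W f k = W g k := by
    intro k h0 hk
    unfold word at h
    rw [List.map_inj_left] at h
    exact h k (by rw [List.mem_range'_1]; omega)
  have key : ∀ k, ∀ d, f d = k → k ≠ 0 → g d = k := by
    intro k
    induction k using Nat.strong_induction_on with
    | _ k ih =>
      intro d hd hk
      have hkN : k ≤ b * n := hd ▸ hf.le d
      obtain ⟨e, he⟩ := hg.surj k hk hkN
      have e1 := W_eq hf.inj hk hd
      have e2 := W_eq hg.inj hk he
      rw [hW k hk hkN, e2] at e1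
      obtain ⟨a, j⟩ := d
      obtain ⟨a', j'⟩ := e
      simp only [cont] at e1
      obtain ⟨ha, hj⟩ := hf.mem (by omega : f (a, j) ≠ 0)
      obtain ⟨ha', hj'⟩ := hg.mem (by omega : g (a', j') ≠ 0)
      rcases lt_trichotomy a a' with hlt | heq | hgt
      · -- the cell `(a, j)` has a smaller entry in `g`
        have hl := hg.smono ha' hj' hlt.le (by omega : j ≤ j') (.inl hlt)
        obtain ⟨d, hd'⟩ := hf.surj (g (a, j)) (hg.pos a j ha hj) (hg.le _)
        have := ih _ (by omega) d hd' (hg.pos a j ha hj)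
        have := hg.inj _ _ (by rw [this]; exact hg.pos a j ha hj) this
        subst this
        omega
      · obtain rfl : j = j' := by omega
        subst heq
        exact he
      · have hl := hf.smono ha hj hgt.le (by omega : j' ≤ j) (.inl hgt)
        have := ih _ (by omega) (a', j') rfl (hf.pos a' j' ha' hj')
        omega
  funext d
  by_cases hd : f d = 0
  · obtain ⟨a, j⟩ := d
    have : ¬ (a < b ∧ j < n) := fun h => hf.pos a j h.1 h.2 hd
    rw [hf.zero _ _ this, hg.zero _ _ this]
  · exact (key _ d rfl hd).symm

/-- The particle state of the cells with entries at most `k`. -/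
def St (b n : ℕ) (f : ℕ × ℕ → ℕ) (k : ℕ) (x : ℤ) : Prop :=
  ∃ a j : ℕ, x = (j : ℤ) - a ∧ ¬ (a < b ∧ j < n ∧ f (a, j) ≤ k) ∧
    (j = 0 ∨ ∃ i, j = i + 1 ∧ a < b ∧ i < n ∧ f (a, i) ≤ k)

theorem Std.path {b n f} (hf : Std b n f) (t : ℕ) : ∀ k, k + t = b * n →
    Path (fun z => -(b : ℤ) < z ∧ z < n) (St b n f k) ((List.range' (k + 1) t).map (W f))
      (St b n f (b * n)) := by
  induction t with
  | zero => rintro k rfl; rfl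
  | succ t ih =>
    intro k hk
    obtain ⟨⟨a0, j0⟩, h0⟩ := hf.surj (k + 1) (by omega) (by omega)
    obtain ⟨ha0, hj0⟩ := hf.mem (by omega : f (a0, j0) ≠ 0)
    rw [List.range'_succ, List.map_cons, W_eq hf.inj (by omega) h0]
    have lo : ∀ a j, a ≤ a0 → j ≤ j0 → (a < a0 ∨ j < j0) → f (a, j) < k + 1 := by
      intro a j h1 h2 h3
      rw [← h0]; exact hf.smono ha0 hj0 h1 h2 h3
    have hi : ∀ a j, a < b → j < n → a0 ≤ a → j0 ≤ j → (a0 < a ∨ j0 < j) → k + 1 < f (a, j) := by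
      intro a j h h' h1 h2 h3
      rw [← h0]; exact hf.smono h h' h1 h2 h3
    have ne : ∀ a j, f (a, j) = k + 1 → a = a0 ∧ j = j0 := by
      intro a j h
      have := hf.inj (a, j) (a0, j0) (by omega) (by omega)
      simpa using this
    have step : hop (cont (a0, j0)) (St b n f k) = St b n f (k + 1) := by
      funext x
      simp only [hop, cont, eq_iff_iff]
      constructor
      · rintro (rfl | ⟨hx, a, j, rfl, h1, h2⟩)
        · refine ⟨a0, j0 + 1, by push_cast; ring, ?_, .inr ⟨j0, rfl, ha0, hj0, h0.le⟩⟩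
          rintro ⟨h1, h2, h3⟩
          have := hi a0 (j0 + 1) h1 h2 le_rfl (by omega) (by omega)
          omega
        · refine ⟨a, j, rfl, ?_, ?_⟩
          · rintro ⟨g1, g2, g3⟩
            have : f (a, j) = k + 1 := by
              by_contra hne; exact h1 ⟨g1, g2, by omega⟩
            obtain ⟨rfl, rfl⟩ := ne _ _ this
            exact hx rfl
          · rcases h2 with h2 | ⟨i, g0, g1, g2, g3⟩
            · exact .inl h2
            · exact .inr ⟨i, g0, g1, g2, by omega⟩
      · rintro ⟨a, j, rfl, h1, h2⟩
        by_cases ha : a = a0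
        · subst ha
          left
          have hj : j0 < j := by
            by_contra hc
            refine h1 ⟨ha0, by omega, ?_⟩
            rcases (by omega : j = j0 ∨ j < j0) with rfl | h
            · exact h0.le
            · exact (lo a j le_rfl h.le (.inr h)).le
          obtain h2 | ⟨i, rfl, g1, g2, g3⟩ := h2
          · omega
          have : i = j0 := by
            by_contra hc
            have := hi a i g1 g2 le_rfl (by omega) (by omega)
            omega
          subst this
          push_cast; ring
        · right
          refine ⟨fun e => ?_, a, j, rfl, fun ⟨g1, g2, g3⟩ => h1 ⟨g1, g2, by omega⟩, ?_⟩
          · rcases lt_or_gt_of_ne ha with hlt | hgt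
            · have := lo a j hlt.le (by omega) (.inl hlt)
              exact h1 ⟨by omega, by omega, by omega⟩
            · obtain h2 | ⟨i, rfl, g1, g2, g3⟩ := h2
              · omega
              · have := hi a i g1 g2 hgt.le (by omega) (.inl hgt)
                omega
          · obtain h2 | ⟨i, rfl, g1, g2, g3⟩ := h2
            · exact .inl h2
            · refine .inr ⟨i, rfl, g1, g2, ?_⟩
              by_contra hc
              exact ha (ne a i (by omega)).1
    refine ⟨by simp only [cont]; omega, ⟨a0, j0, rfl, by omega, ?_⟩, ?_, ?_⟩
    · rcases Nat.eq_zero_or_pos j0 with h | h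
      · exact .inl h
      · refine .inr ⟨j0 - 1, by omega, ha0, by omega, ?_⟩
        have := lo a0 (j0 - 1) le_rfl (by omega) (by omega)
        omega
    · rintro ⟨a, j, e, h1, h2⟩
      simp only [cont] at e
      rcases lt_trichotomy a a0 with hlt | rfl | hgt
      · have := lo a j hlt.le (by omega) (.inl hlt)
        exact h1 ⟨by omega, by omega, by omega⟩
      · obtain h2 | ⟨i, rfl, g1, g2, g3⟩ := h2
        · omega
        · obtain rfl : i = j0 := by omega
          omega
      · obtain h2 | ⟨i, rfl, g1, g2, g3⟩ := h2
        · omega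
        · have := hi a i g1 g2 hgt.le (by omega) (.inl hgt)
          omega
    · rw [step]
      exact ih (k + 1) (by omega)

theorem Std.word_order {b n f} (hf : Std b n f) :
    prom^[b * n] (word (b * n) f) = word (b * n) f := by
  have p := hf.path (b * n) 0 (by omega)
  have hl : (word (b * n) f).length = b * n := by simp [word]
  have := prom_order (A := fun z => -(b : ℤ) < z ∧ z < n) (by intros; omega) ?_ ?_ p
  · rw [show 0 + 1 = 1 from rfl] at this
    change prom^[(word (b * n) f).length] (word (b * n) f) = word (b * n) f at this
    rwa [hl] at this
  · rintro z hz ⟨a, j, e, h1, h2⟩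
    obtain h2 | ⟨i, rfl, g1, g2, g3⟩ := h2
    · subst h2
      refine ⟨a + 1, 0, by push_cast at e ⊢; omega, fun ⟨g1, g2, g3⟩ => ?_, .inl rfl⟩
      exact hf.pos _ _ g1 g2 (by omega)
    · exact absurd (by omega) (hf.pos _ _ g1 g2)
  · rintro z hz ⟨a, j, e, h1, h2⟩
    have hF : ¬ (a < b ∧ j < n) := fun h => h1 ⟨h.1, h.2, hf.le _⟩
    have h2' : j = 0 ∨ (a < b ∧ j ≤ n) := by
      obtain h2 | ⟨i, rfl, g1, g2, g3⟩ := h2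
      · exact .inl h2
      · exact .inr ⟨g1, g2⟩
    have hz' : -(b : ℤ) < z ∧ z < n := by
      first | exact hz | (have := hz; dsimp only at this; omega)
    clear h1 h2 hz
    have : a < b ∧ j = n := by omega
    obtain ⟨ha, rfl⟩ := this
    refine ⟨a - 1, j, by omega, by omega, ?_⟩
    rcases Nat.eq_zero_or_pos j with h | h
    · exact .inl h
    · exact .inr ⟨j - 1, by omega, by omega, by omega, hf.le _⟩

/-- A standard filling of the rectangle with a hole at `(a, j)`. -/
structure Holed (b n : ℕ) (f : ℕ × ℕ → ℕ) (a j : ℕ) : Prop where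
  ha : a < b
  hj : j < n
  zero : ∀ x y, ¬ (x < b ∧ y < n) → f (x, y) = 0
  hole : f (a, j) = 0
  pos : ∀ x y, x < b → y < n → ¬ (x = a ∧ y = j) → f (x, y) ≠ 0
  inj : ∀ d e, f d ≠ 0 → f d = f e → d = e
  mono : ∀ x y x' y', x' < b → y' < n → ¬ (x' = a ∧ y' = j) → x ≤ x' → y ≤ y' →
    f (x, y) ≤ f (x', y')
  surj : ∀ v, v ≠ 0 → v < b * n → ∃ d, f d = v
  bound : ∀ d, f d < b * n

theorem Holed.mem {b n f a j} (h : Holed b n f a j) {x y} (h' : f (x, y) ≠ 0) : x < b ∧ y < n := by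
  by_contra hc; exact h' (h.zero x y hc)

theorem push_far (p : ℤ) (S : List ℤ) (h : ∀ q ∈ S, ¬ (p = q + 1 ∨ q = p + 1)) :
    push p S = (S, p) := by
  induction S with
  | nil => rfl
  | cons q S ih =>
    simp only [push]
    rw [if_neg (h q (by simp)), ih fun q hq => h q (by simp [hq])]

theorem Holed.far {b n f a j} (h : Holed b n f a j) {v k : ℕ}
    (lo : ∀ x y, x ≤ a → y ≤ j → f (x, y) ≤ v)
    (hi : ∀ x y, x < b → y < n → a ≤ x → j ≤ y → ¬ (x = a ∧ y = j) → k < f (x, y))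
    (hk : v < k) (hkN : k < b * n) :
    ¬ (cont (a, j) = W f k + 1 ∨ W f k = cont (a, j) + 1) := by
  obtain ⟨⟨x, y⟩, e⟩ := h.surj k (by omega) hkN
  obtain ⟨hx, hy⟩ := h.mem (by omega : f (x, y) ≠ 0)
  rw [W_eq h.inj (by omega) e]
  simp only [cont]
  have A : ¬ (x ≤ a ∧ y ≤ j) := fun g => by
    have := lo x y g.1 g.2
    omega
  have B : ¬ (a ≤ x ∧ j ≤ y) := fun g => by
    by_cases g' : x = a ∧ y = j
    · obtain ⟨rfl, rfl⟩ := g'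
      have := h.hole
      omega
    · have := hi x y hx hy g.1 g.2 g'
      omega
  omega

theorem Holed.step {b n f a j} (h : Holed b n f a j) {f' : ℕ × ℕ → ℕ} {a' j' v : ℕ}
    (hc : (a' = a ∧ j' = j + 1) ∨ (a' = a + 1 ∧ j' = j))
    (lo : ∀ x y, x ≤ a → y ≤ j → f (x, y) ≤ v) (hv : v < f (a', j'))
    (hi : ∀ x y, x < b → y < n → a ≤ x → j ≤ y → ¬ (x = a ∧ y = j) → f (a', j') ≤ f (x, y))
    (e1 : f' (a, j) = f (a', j')) (e2 : f' (a', j') = 0)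
    (e3 : ∀ x y, ¬ (x = a ∧ y = j) → ¬ (x = a' ∧ y = j') → f' (x, y) = f (x, y)) :
    Holed b n f' a' j' := by
  obtain ⟨ha', hj'⟩ := h.mem (by omega : f (a', j') ≠ 0)
  have ha := h.ha
  have hj := h.hj
  refine ⟨ha', hj', ?_, e2, ?_, ?_, ?_, ?_, ?_⟩
  · intro x y g
    rw [e3 x y (by rintro ⟨rfl, rfl⟩; exact g ⟨ha, hj⟩) (by rintro ⟨rfl, rfl⟩; exact g ⟨ha', hj'⟩)]
    exact h.zero x y g
  · intro x y gx gy g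
    by_cases g' : x = a ∧ y = j
    · obtain ⟨rfl, rfl⟩ := g'
      omega
    · rw [e3 x y g' g]
      exact h.pos x y gx gy g'
  · rintro ⟨x, y⟩ ⟨x', y'⟩ g e
    by_cases g1 : x = a ∧ y = j
    · by_cases g2 : x' = a ∧ y' = j
      · rw [g1.1, g1.2, g2.1, g2.2]
      · exfalso
        obtain ⟨rfl, rfl⟩ := g1
        by_cases g3 : x' = a' ∧ y' = j'
        · obtain ⟨rfl, rfl⟩ := g3
          omega
        · rw [e3 x' y' g2 g3, e1] at e
          have := h.inj _ _ (by omega) e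
          simp only [Prod.mk.injEq] at this
          omega
    · have g0 : ¬ (x = a' ∧ y = j') := by
        rintro ⟨rfl, rfl⟩
        exact g e2
      rw [e3 x y g1 g0] at e g
      by_cases g2 : x' = a ∧ y' = j
      · obtain ⟨rfl, rfl⟩ := g2
        rw [e1] at e
        have := h.inj _ _ g e
        simp only [Prod.mk.injEq] at this
        omega
      · by_cases g3 : x' = a' ∧ y' = j'
        · obtain ⟨rfl, rfl⟩ := g3
          omega
        · rw [e3 x' y' g2 g3] at e
          exact h.inj _ _ g e
  · intro x y x' y' hx' hy' g hx hy
    by_cases g3 : x = a' ∧ y = j'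
    · obtain ⟨rfl, rfl⟩ := g3
      omega
    by_cases g1 : x' = a ∧ y' = j
    · obtain ⟨rfl, rfl⟩ := g1
      by_cases g2 : x = x' ∧ y = y'
      · rw [g2.1, g2.2]
      · rw [e3 x y g2 g3, e1]
        have := lo x y hx hy
        omega
    · rw [e3 x' y' g1 g]
      by_cases g2 : x = a ∧ y = j
      · obtain ⟨rfl, rfl⟩ := g2
        rw [e1]
        exact hi x' y' hx' hy' hx hy g1
      · rw [e3 x y g2 g3]
        exact h.mono x y x' y' hx' hy' g1 hx hy
  · intro k hk hkN
    obtain ⟨⟨x, y⟩, e⟩ := h.surj k hk hkN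
    by_cases g1 : x = a' ∧ y = j'
    · obtain ⟨rfl, rfl⟩ := g1
      exact ⟨(a, j), by omega⟩
    · refine ⟨(x, y), ?_⟩
      rw [e3 x y ?_ g1, e]
      rintro ⟨rfl, rfl⟩
      have := h.hole
      omega
  · rintro ⟨x, y⟩
    by_cases g1 : x = a ∧ y = j
    · rw [g1.1, g1.2, e1]; exact h.bound _
    · by_cases g2 : x = a' ∧ y = j'
      · rw [g2.1, g2.2, e2]
        have := h.bound (a, j)
        omega
      · rw [e3 x y g1 g2]; exact h.bound _

/-- The outcome of a slide. -/
def Good (b n : ℕ) (f : ℕ × ℕ → ℕ) (a j v : ℕ) (s : (ℕ × ℕ → ℕ) × (ℕ × ℕ)) : Prop :=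
  s.2 = (b - 1, n - 1) ∧ Holed b n s.1 (b - 1) (n - 1) ∧
    (∀ d, f d ≠ 0 → f d ≤ v → s.1 d = f d) ∧
    push (cont (a, j)) ((List.range' (v + 1) (b * n - 1 - v)).map (W f)) =
      ((List.range' (v + 1) (b * n - 1 - v)).map (W s.1), cont (b - 1, n - 1))

theorem Holed.terminal {b n f a j} (h : Holed b n f a j) {v : ℕ}
    (lo : ∀ x y, x ≤ a → y ≤ j → f (x, y) ≤ v) (h1 : a = b - 1) (h2 : j = n - 1) :
    Good b n f a j v (f, (a, j)) := by
  refine ⟨by rw [h1, h2], by rw [← h1, ← h2]; exact h, fun _ _ _ => rfl, ?_⟩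
  rw [← h1, ← h2]
  refine push_far _ _ fun q hq => ?_
  rw [List.mem_map] at hq
  obtain ⟨k, hk, rfl⟩ := hq
  rw [List.mem_range'_1] at hk
  refine h.far lo (fun x y hx hy g1 g2 g3 => ?_) (by omega) (by omega)
  omega

theorem Holed.slide_step {b n f a j} (h : Holed b n f a j) {f' : ℕ × ℕ → ℕ} {a' j' v : ℕ}
    (hc : (a' = a ∧ j' = j + 1) ∨ (a' = a + 1 ∧ j' = j))
    (lo : ∀ x y, x ≤ a → y ≤ j → f (x, y) ≤ v) (hv : v < f (a', j'))
    (hi : ∀ x y, x < b → y < n → a ≤ x → j ≤ y → ¬ (x = a ∧ y = j) → f (a', j') ≤ f (x, y))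
    (e1 : f' (a, j) = f (a', j')) (e2 : f' (a', j') = 0)
    (e3 : ∀ x y, ¬ (x = a ∧ y = j) → ¬ (x = a' ∧ y = j') → f' (x, y) = f (x, y))
    (s : (ℕ × ℕ → ℕ) × (ℕ × ℕ))
    (ih : Holed b n f' a' j' → (∀ x y, x ≤ a' → y ≤ j' → f' (x, y) ≤ f (a', j')) →
      (∀ x y, x < b → y < n → a' ≤ x → j' ≤ y → ¬ (x = a' ∧ y = j') → f (a', j') < f' (x, y)) →
      Good b n f' a' j' (f (a', j')) s) : Good b n f a j v s := by
  have H' := h.step hc lo hv hi e1 e2 e3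
  obtain ⟨ha', hj'⟩ := h.mem (by omega : f (a', j') ≠ 0)
  have hne : ¬ (a' = a ∧ j' = j) := by omega
  specialize ih H' ?_ ?_
  · intro x y hx hy
    by_cases g1 : x = a ∧ y = j
    · rw [g1.1, g1.2, e1]
    · by_cases g2 : x = a' ∧ y = j'
      · rw [g2.1, g2.2, e2]; omega
      · rw [e3 x y g1 g2]
        exact h.mono x y a' j' ha' hj' hne hx hy
  · intro x y hx hy gx gy g
    have g1 : ¬ (x = a ∧ y = j) := by omega
    rw [e3 x y g1 g]
    refine lt_of_le_of_ne (hi x y hx hy (by omega) (by omega) g1) fun e => ?_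
    have := h.inj _ _ (by omega) e
    simp only [Prod.mk.injEq] at this
    omega
  obtain ⟨i1, i2, i3, i4⟩ := ih
  obtain ⟨g, e⟩ := s
  simp only at i1 i2 i3 i4
  set r := f (a', j') with hr
  have hrN : r < b * n := h.bound _
  have keep : ∀ d, f d ≠ 0 → f d < r → g d = f d := by
    rintro ⟨x, y⟩ g0 g1
    have q1 : ¬ (x = a ∧ y = j) := by
      rintro ⟨rfl, rfl⟩
      exact g0 h.hole
    have q2 : ¬ (x = a' ∧ y = j') := by
      rintro ⟨rfl, rfl⟩
      omega
    have q := e3 x y q1 q2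
    rw [i3 _ (by omega) (by omega), q]
  refine ⟨i1, i2, fun d g0 g1 => keep d g0 (by omega), ?_⟩
  have hsplit : List.range' (v + 1) (b * n - 1 - v) =
      List.range' (v + 1) (r - 1 - v) ++ r :: List.range' (r + 1) (b * n - 1 - r) := by
    rw [show b * n - 1 - v = (r - 1 - v) + ((b * n - 1 - r) + 1) by omega,
      ← List.range'_append_1, show v + 1 + (r - 1 - v) = r by omega, List.range'_succ]
  have Wlow : ∀ k ∈ List.range' (v + 1) (r - 1 - v), W f k = W g k := by
    intro k hk
    rw [List.mem_range'_1] at hk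
    obtain ⟨d, hd⟩ := h.surj k (by omega) (by omega)
    rw [W_eq h.inj (by omega) hd, W_eq i2.inj (by omega) ((keep d (by omega) (by omega)).trans hd)]
  have Whigh : ∀ k ∈ List.range' (r + 1) (b * n - 1 - r), W f k = W f' k := by
    intro k hk
    rw [List.mem_range'_1] at hk
    obtain ⟨⟨x, y⟩, hd⟩ := h.surj k (by omega) (by omega)
    have q1 : ¬ (x = a ∧ y = j) := by
      rintro ⟨rfl, rfl⟩
      have := h.hole
      omega
    have q2 : ¬ (x = a' ∧ y = j') := by
      rintro ⟨rfl, rfl⟩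
      omega
    rw [W_eq h.inj (by omega) hd, W_eq H'.inj (by omega) ((e3 x y q1 q2).trans hd)]
  have Wr : W f r = cont (a', j') := W_eq h.inj (by omega) hr.symm
  have Wgr : W g r = cont (a, j) :=
    W_eq i2.inj (by omega) (by rw [i3 _ (by omega) (by omega), e1])
  have hfar : push (cont (a, j)) ((List.range' (v + 1) (r - 1 - v)).map (W f)) =
      ((List.range' (v + 1) (r - 1 - v)).map (W f), cont (a, j)) := by
    refine push_far _ _ fun q hq => ?_
    rw [List.mem_map] at hq
    obtain ⟨k, hk, rfl⟩ := hq
    rw [List.mem_range'_1] at hk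
    refine h.far lo (fun x y hx hy g1 g2 g3 => ?_) (by omega) (by omega)
    have := hi x y hx hy g1 g2 g3
    omega
  have hadj : cont (a, j) = cont (a', j') + 1 ∨ cont (a', j') = cont (a, j) + 1 := by
    simp only [cont]
    omega
  rw [hsplit, List.map_append, List.map_cons, push_append, hfar]
  simp only [push]
  rw [Wr, if_pos hadj, List.map_congr_left Whigh, i4, List.map_append, List.map_cons, Wgr,
    List.map_congr_left Wlow]

theorem Holed.slide {b n : ℕ} (fuel : ℕ) : ∀ f a j v, Holed b n f a j →
    (∀ x y, x ≤ a → y ≤ j → f (x, y) ≤ v) →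
    (∀ x y, x < b → y < n → a ≤ x → j ≤ y → ¬ (x = a ∧ y = j) → v < f (x, y)) →
    (b - 1 - a) + (n - 1 - j) ≤ fuel → Good b n f a j v (jdtSlide fuel f (a, j)) := by
  induction fuel with
  | zero =>
    intro f a j v h lo hi hfuel
    have := h.ha
    have := h.hj
    exact h.terminal lo (by omega) (by omega)
  | succ fuel ih =>
    intro f a j v h lo hi hfuel
    have ha := h.ha
    have hj := h.hj
    have right : ∀ x y, x < b → y < n → a ≤ x → j + 1 ≤ y → f (a, j + 1) ≤ f (x, y) :=
      fun x y hx hy g1 g2 => h.mono _ _ _ _ hx hy (by omega) g1 g2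
    have down : ∀ x y, x < b → y < n → a + 1 ≤ x → j ≤ y → f (a + 1, j) ≤ f (x, y) :=
      fun x y hx hy g1 g2 => h.mono _ _ _ _ hx hy (by omega) g1 g2
    have rpos : j + 1 < n → f (a, j + 1) ≠ 0 := fun g => h.pos _ _ ha g (by omega)
    have dpos : a + 1 < b → f (a + 1, j) ≠ 0 := fun g => h.pos _ _ g hj (by omega)
    simp only [jdtSlide]
    split_ifs with c1 c2
    · refine h.terminal lo ?_ ?_
      · by_contra; exact dpos (by omega) c1.2
      · by_contra; exact rpos (by omega) c1.1
    · have hr : f (a, j + 1) ≠ 0 := by omega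
      obtain ⟨m1, m2⟩ := h.mem hr
      refine h.slide_step (a' := a) (j' := j + 1) (.inl ⟨rfl, rfl⟩) lo
        (hi _ _ m1 m2 le_rfl (by omega) (by omega)) ?_ (by simp) ?_ ?_ _
        (fun k1 k2 k3 => ih _ _ _ _ k1 k2 k3 (by omega))
      · intro x y hx hy gx gy g
        rcases (by omega : j + 1 ≤ y ∨ a + 1 ≤ x) with q | q
        · exact right x y hx hy gx q
        · have := down x y hx hy q gy
          have := dpos (by omega)
          omega
      · rw [Function.update_of_ne (by simp), Function.update_self]
      · intro x y g1 g2
        rw [Function.update_of_ne (by simpa using g1), Function.update_of_ne (by simpa using g2)]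
    · have hr : f (a + 1, j) ≠ 0 := by omega
      obtain ⟨m1, m2⟩ := h.mem hr
      refine h.slide_step (a' := a + 1) (j' := j) (.inr ⟨rfl, rfl⟩) lo
        (hi _ _ m1 m2 (by omega) le_rfl (by omega)) ?_ (by simp) ?_ ?_ _
        (fun k1 k2 k3 => ih _ _ _ _ k1 k2 k3 (by omega))
      · intro x y hx hy gx gy g
        rcases (by omega : j + 1 ≤ y ∨ a + 1 ≤ x) with q | q
        · have := right x y hx hy gx q
          have := rpos (by omega)
          omega
        · exact down x y hx hy q gy
      · rw [Function.update_of_ne (by simp), Function.update_self]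
      · intro x y g1 g2
        rw [Function.update_of_ne (by simpa using g1), Function.update_of_ne (by simpa using g2)]

/-- Promotion of tableaux is promotion of content words. -/
theorem Std.promote {b n f} (hf : Std b n f) (hb : 0 < b) (hn : 0 < n) :
    Std b n (promote (b * n) f) ∧ word (b * n) (_root_.promote (b * n) f) = prom (word (b * n) f) := by
  have hN : 0 < b * n := Nat.mul_pos hb hn
  have hN' : b - 1 + (n - 1) ≤ b * n := by
    obtain ⟨b, rfl⟩ : ∃ k, b = k + 1 := ⟨b - 1, by omega⟩
    obtain ⟨n, rfl⟩ : ∃ k, n = k + 1 := ⟨n - 1, by omega⟩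
    simp only [Nat.add_sub_cancel]
    nlinarith [Nat.zero_le (b * n)]
  have f00 : f (0, 0) = 1 := by
    obtain ⟨⟨x, y⟩, e⟩ := hf.surj 1 one_ne_zero hN
    obtain ⟨hx, hy⟩ := hf.mem (by omega : f (x, y) ≠ 0)
    have := hf.mono 0 0 x y hx hy (by omega) (by omega)
    have := hf.pos 0 0 hb hn
    omega
  have gt : ∀ x y, x < b → y < n → ¬ (x = 0 ∧ y = 0) → 1 < f (x, y) := by
    intro x y hx hy g
    rw [← f00]
    exact hf.smono hx hy (by omega) (by omega) (by omega)
  have H : Holed b n (fun c => f c - 1) 0 0 := by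
    refine ⟨hb, hn, ?_, by simp [f00], ?_, ?_, ?_, ?_, ?_⟩
    · intro x y g
      simp [hf.zero x y g]
    · intro x y hx hy g
      have := gt x y hx hy g
      omega
    · intro d e g g'
      exact hf.inj d e (by omega) (by omega)
    · intro x y x' y' hx hy g g1 g2
      have := hf.mono x y x' y' hx hy g1 g2
      omega
    · intro k hk hkN
      obtain ⟨d, hd⟩ := hf.surj (k + 1) (by omega) (by omega)
      exact ⟨d, by simp [hd]⟩
    · intro d
      have := hf.le d
      omega
  have G := H.slide (b * n) _ 0 0 0 (by
    intro x y hx hy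
    obtain rfl : x = 0 := by omega
    obtain rfl : y = 0 := by omega
    simp [f00]) (by
    intro x y hx hy _ _ g
    have := gt x y hx hy g
    omega) (by omega)
  unfold _root_.promote
  simp only
  generalize jdtSlide (b * n) (fun c => f c - 1) (0, 0) = s at G
  obtain ⟨g, e⟩ := s
  obtain ⟨G1, G2, -, G3⟩ := G
  simp only at G1 G2 G3
  subst G1
  simp only
  set F := Function.update g (b - 1, n - 1) (b * n) with hF
  have F1 : F (b - 1, n - 1) = b * n := by simp [hF]
  have F2 : ∀ d, d ≠ (b - 1, n - 1) → F d = g d := fun d hd => by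
    rw [hF, Function.update_of_ne hd]
  have F3 : ∀ d, g d ≠ 0 → F d = g d := fun d hd => F2 d (by
    rintro rfl
    exact hd G2.hole)
  have S : Std b n F := by
    refine ⟨?_, ?_, ?_, ?_, ?_, ?_⟩
    · intro x y g0
      rw [F2 _ (by simp only [ne_eq, Prod.mk.injEq]; omega)]
      exact G2.zero x y g0
    · intro x y hx hy
      by_cases q : x = b - 1 ∧ y = n - 1
      · rw [q.1, q.2, F1]; omega
      · rw [F2 _ (by simpa using q)]
        exact G2.pos x y hx hy q
    · intro d
      by_cases q : d = (b - 1, n - 1)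
      · rw [q, F1]
      · rw [F2 d q]; exact (G2.bound d).le
    · intro d e g0 g1
      by_cases q : d = (b - 1, n - 1)
      · by_cases q' : e = (b - 1, n - 1)
        · rw [q, q']
        · rw [F2 e q', q, F1] at g1
          have := G2.bound e
          omega
      · rw [F2 d q] at g0 g1
        by_cases q' : e = (b - 1, n - 1)
        · rw [q', F1] at g1
          have := G2.bound d
          omega
        · rw [F2 e q'] at g1
          exact G2.inj d e g0 g1
    · intro k hk hkN
      rcases (by omega : k = b * n ∨ k < b * n) with rfl | q
      · exact ⟨_, F1⟩
      · obtain ⟨d, hd⟩ := G2.surj k hk q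
        exact ⟨d, by rw [F3 d (by omega), hd]⟩
    · intro x y x' y' hx hy g1 g2
      by_cases q : x' = b - 1 ∧ y' = n - 1
      · rw [q.1, q.2, F1]
        by_cases q' : (x, y) = (b - 1, n - 1)
        · rw [q', F1]
        · rw [F2 _ q']; exact (G2.bound _).le
      · rw [F2 (x', y') (by simpa using q), F2 (x, y) (by simp only [ne_eq, Prod.mk.injEq]; omega)]
        exact G2.mono x y x' y' hx hy q g1 g2
  refine ⟨S, ?_⟩
  have w1 : word (b * n) f =
      cont (0, 0) :: (List.range' (0 + 1) (b * n - 1 - 0)).map (W (fun c => f c - 1)) := by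
    unfold word
    rw [show b * n = (b * n - 1) + 1 by omega, List.range'_succ, List.map_cons,
      W_eq hf.inj one_ne_zero f00]
    congr 1
    rw [show b * n - 1 + 1 - 1 - 0 = b * n - 1 by omega]
    apply List.ext_getElem (by simp)
    intro i h1 h2
    simp only [List.length_map, List.length_range'] at h1
    simp only [List.getElem_map, List.getElem_range']
    obtain ⟨d, hd⟩ := hf.surj (1 + 1 + 1 * i) (by omega) (by omega)
    rw [W_eq hf.inj (by omega) hd, W_eq H.inj (d := d) (by omega) (by omega)]
  have w2 : word (b * n) F =
      (List.range' (0 + 1) (b * n - 1 - 0)).map (W g) ++ [cont (b - 1, n - 1)] := by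
    unfold word
    have : List.range' 1 (b * n) = List.range' (0 + 1) (b * n - 1 - 0) ++ [b * n] := by
      conv_lhs => rw [show b * n = (b * n - 1) + 1 by omega, ← List.range'_append_1]
      rw [show 1 + (b * n - 1) = b * n by omega]
      rfl
    rw [this, List.map_append, List.map_cons, List.map_nil, W_eq S.inj (by omega) F1]
    congr 1
    apply List.map_congr_left
    intro k hk
    rw [List.mem_range'_1] at hk
    obtain ⟨d, hd⟩ := G2.surj k (by omega) (by omega)
    rw [W_eq G2.inj (by omega) hd, W_eq S.inj (by omega) ((F3 d (by omega)).trans hd)]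
  rw [w1, w2]
  simp only [prom]
  rw [G3]

theorem Std.iter {b n f} (hf : Std b n f) (hb : 0 < b) (hn : 0 < n) (i : ℕ) :
    Std b n ((_root_.promote (b * n))^[i] f) ∧
      word (b * n) ((_root_.promote (b * n))^[i] f) = prom^[i] (word (b * n) f) := by
  induction i with
  | zero => exact ⟨hf, rfl⟩
  | succ i ih =>
    rw [Function.iterate_succ_apply', Function.iterate_succ_apply']
    have := ih.1.promote hb hn
    exact ⟨this.1, by rw [this.2, ih.2]⟩

end PromRect


/-- (Haiman, Theorem 4.4.)  If `λ ⊢ N = b·n` is a rectangle with `b` rows and `n` columns,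
then `p^N(T) = T` for every standard Young tableau `T` of shape `λ`, where `p` is jeu de
taquin promotion. -/
theorem promotion_order_on_rectangles (b n : ℕ) (f : (ℕ × ℕ) → ℕ)
    (hf : IsStdFilling (strCell (rectShape b n)) (b * n) f) :
    (promote (b * n))^[b * n] f = f := by
  rcases Nat.eq_zero_or_pos (b * n) with h0 | h0
  · rw [h0]; rfl
  · have hS := PromRect.Std.of hf
    have hb : 0 < b := Nat.pos_of_mul_pos_right h0
    have hn : 0 < n := Nat.pos_of_mul_pos_left h0
    have hi := hS.iter hb hn (b * n)
    exact hi.1.ext hS (hi.2.trans hS.word_order)
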